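/- Let ρ be a probability measure on ℝ with exponential moment of order η and positive drift λ. If η₀ > 0 is small enough and l ≥ 0 is such that ρ is l-weakly-diophantine, then there exists C > 0 such that the only z in the region {z ∈ ℂ : |Re(z)| < η₀ and Re(z) ≥ −C/(1 + |Im(z)|^l)} with ρ̂(z) = 1 is z = 0. (Direction: weakly-diophantine ⟹ zero-free region; uses that ρ̂' is uniformly bounded on the strip.) -/

import Mathlib

open MeasureTheory

lemma aux_lat (ρ : Measure ℝ) [IsProbabilityMeasure ρ] (b : ℝ)
    (h : ∫ y, Complex.exp (-(Complex.I * b) * (y : ℂ)) ∂ρ = 1) (n : ℕ) :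
    ∫ y, Complex.exp (-(Complex.I * ((n * b : ℝ) : ℂ)) * (y : ℂ)) ∂ρ = 1 := by
  have hnorm : ∀ y : ℝ, ‖Complex.exp (-(Complex.I * b) * (y : ℂ))‖ = 1 := by
    intro y
    rw [Complex.norm_exp]
    simp
  have hint : Integrable (fun y : ℝ => Complex.exp (-(Complex.I * b) * (y : ℂ))) ρ := by
    refine Integrable.of_bound (C := 1) (by fun_prop) (Filter.Eventually.of_forall fun y => ?_)
    exact (hnorm y).le
  have hre : ∫ y, (Complex.exp (-(Complex.I * b) * (y : ℂ))).re ∂ρ = 1 := by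
    have := integral_re hint
    simp only [RCLike.re_to_complex] at this
    rw [this, h]; simp
  have hintre : Integrable (fun y : ℝ => (Complex.exp (-(Complex.I * b) * (y : ℂ))).re) ρ := hint.re
  have h0 : ∫ y, (1 - (Complex.exp (-(Complex.I * b) * (y : ℂ))).re) ∂ρ = 0 := by
    rw [integral_sub (integrable_const _) hintre, hre]; simp
  have hae := (integral_eq_zero_iff_of_nonneg (fun y => by
    have := Complex.re_le_norm (Complex.exp (-(Complex.I * b) * (y : ℂ)))
    rw [hnorm] at this
    simpa using this) ((integrable_const _).sub hintre)).1 h0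
  have : ∀ᵐ y : ℝ ∂ρ, Complex.exp (-(Complex.I * ((n * b : ℝ) : ℂ)) * (y : ℂ)) = 1 := by
    filter_upwards [hae] with y hy
    have h1 : (Complex.exp (-(Complex.I * b) * (y : ℂ))).re = 1 := by
      simp only [Pi.zero_apply, Pi.sub_apply] at hy; linarith
    have h2 : Complex.exp (-(Complex.I * b) * (y : ℂ)) = 1 := by
      have h3 := hnorm y
      have h4 := Complex.sq_norm (Complex.exp (-(Complex.I * b) * (y : ℂ)))
      rw [h3, Complex.normSq_apply, h1] at h4
      apply Complex.ext
      · simpa using h1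
      · have : (Complex.exp (-(Complex.I * b) * (y : ℂ))).im = 0 := by nlinarith
        simpa using this
    have : (-(Complex.I * ((n * b : ℝ) : ℂ)) * (y : ℂ)) = n * (-(Complex.I * b) * (y : ℂ)) := by
      push_cast; ring
    rw [this, Complex.exp_nat_mul, h2, one_pow]
  rw [integral_congr_ae this]; simp

lemma aux_exp (x : ℝ) : |Real.exp x - 1| ≤ |x| * Real.exp |x| := by
  have h1 := Real.add_one_le_exp x
  have h2 := Real.add_one_le_exp (-x)
  have h3 : Real.exp x * Real.exp (-x) = 1 := by rw [← Real.exp_add]; simp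
  have h4 := Real.exp_pos x
  have h5 : 1 ≤ Real.exp |x| := Real.one_le_exp (abs_nonneg x)
  rcases le_total 0 x with h | h
  · rw [abs_of_nonneg h]
    rw [abs_of_nonneg (by linarith)]
    nlinarith
  · rw [abs_of_nonpos (by linarith [Real.exp_le_one_iff.2 h])]
    rw [abs_of_nonpos h] at *
    nlinarith

lemma aux_int (ρ : Measure ℝ) [IsProbabilityMeasure ρ] (η : ℝ)
    (hmom : Integrable (fun y => Real.exp (η * |y|)) ρ) (z : ℂ) (hz : |z.re| ≤ η) :
    Integrable (fun y : ℝ => Complex.exp (-z * (y : ℂ))) ρ := by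
  refine hmom.mono' (by fun_prop) (Filter.Eventually.of_forall fun y => ?_)
  rw [Complex.norm_exp]
  simp only [Complex.mul_re, Complex.neg_re, Complex.ofReal_re, Complex.ofReal_im, mul_zero, sub_zero]
  apply Real.exp_le_exp.2
  calc -z.re * y ≤ |(-z.re) * y| := le_abs_self _
    _ = |z.re| * |y| := by rw [abs_mul, abs_neg]
    _ ≤ _ := by gcongr

lemma aux_lip (ρ : Measure ℝ) [IsProbabilityMeasure ρ] (η : ℝ) (hη : 0 < η)
    (hmom : Integrable (fun y => Real.exp (η * |y|)) ρ) (z : ℂ) (hz : |z.re| ≤ η / 2) :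
    ‖(∫ y, Complex.exp (-z * (y : ℂ)) ∂ρ) -
      ∫ y, Complex.exp (-(Complex.I * (z.im : ℂ)) * (y : ℂ)) ∂ρ‖ ≤
      |z.re| * (2 / η * ∫ y, Real.exp (η * |y|) ∂ρ) := by
  rw [← integral_sub (aux_int ρ η hmom z (by linarith))
    (aux_int ρ η hmom (Complex.I * (z.im : ℂ)) (by simp [hη.le]))]
  rw [← integral_const_mul, ← integral_const_mul]
  refine norm_integral_le_of_norm_le ((hmom.const_mul _).const_mul _)
    (Filter.Eventually.of_forall fun y => ?_)
  have e : Complex.exp (-z * (y : ℂ)) = Complex.exp (-(Complex.I * (z.im : ℂ)) * (y : ℂ)) *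
      ((Real.exp (-z.re * y) : ℝ) : ℂ) := by
    rw [Complex.ofReal_exp, ← Complex.exp_add]
    congr 1
    conv_lhs => rw [← Complex.re_add_im z]
    push_cast; ring
  have e2 : Complex.exp (-z * (y : ℂ)) - Complex.exp (-(Complex.I * (z.im : ℂ)) * (y : ℂ)) =
      Complex.exp (-(Complex.I * (z.im : ℂ)) * (y : ℂ)) *
      ((Real.exp (-z.re * y) - 1 : ℝ) : ℂ) := by
    rw [e]; push_cast; ring
  rw [e2, norm_mul, Complex.norm_exp, Complex.norm_real, Real.norm_eq_abs]
  have : (-(Complex.I * (z.im : ℂ)) * (y : ℂ)).re = 0 := by simp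
  rw [this, Real.exp_zero, one_mul]
  refine (aux_exp _).trans ?_
  rw [abs_mul, abs_neg, mul_assoc]
  refine mul_le_mul_of_nonneg_left ?_ (abs_nonneg _)
  have h1 : |y| ≤ 2 / η * Real.exp (η / 2 * |y|) := by
    have := Real.add_one_le_exp (η / 2 * |y|)
    calc |y| = 2 / η * (η / 2 * |y|) := by field_simp
      _ ≤ _ := by gcongr; linarith
  calc |y| * Real.exp (|z.re| * |y|) ≤ (2 / η * Real.exp (η / 2 * |y|)) * Real.exp (η / 2 * |y|) := by
        gcongr
    _ = _ := by
        rw [mul_assoc, ← Real.exp_add]; congr 2; ring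

theorem stmt13 (ρ : Measure ℝ) [IsProbabilityMeasure ρ] (η : ℝ) (hη : 0 < η)
    (hmom : Integrable (fun y => Real.exp (η * |y|)) ρ)
    (hdrift : 0 < ∫ y, y ∂ρ)
    (l : ℝ) (hl : 0 ≤ l)
    (hwd : ∃ c > (0:ℝ), ∃ B : ℝ, ∀ b : ℝ, B ≤ |b| →
      c ≤ |b| ^ l * ‖1 - ∫ y, Complex.exp (-(Complex.I * b) * (y : ℂ)) ∂ρ‖) :
    ∃ η₀ > (0:ℝ), ∃ C > (0:ℝ), ∀ z : ℂ, |z.re| < η₀ →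
      -C / (1 + |z.im| ^ l) ≤ z.re →
      (∫ y, Complex.exp (-z * (y : ℂ)) ∂ρ) = 1 → z = 0 := by
  obtain ⟨c, hc, B, hB⟩ := hwd
  -- no zeros on the imaginary axis
  have haxis : ∀ b : ℝ, b ≠ 0 →
      0 < ‖1 - ∫ y, Complex.exp (-(Complex.I * b) * (y : ℂ)) ∂ρ‖ := by
    intro b hb
    rw [norm_pos_iff]
    intro h
    have h1 := aux_lat ρ b (sub_eq_zero.1 h).symm
    obtain ⟨n, hn⟩ := exists_nat_ge (B / |b|)
    have h2 := hB (n * b) (by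
      rw [abs_mul, Nat.abs_cast]
      rwa [div_le_iff₀ (abs_pos.2 hb)] at hn)
    rw [h1 n] at h2
    simp at h2
    linarith
  have hsub : Set.Ioo (-η) η ⊆ ProbabilityTheory.integrableExpSet id ρ := by
    intro t ht
    have := (aux_int ρ η hmom (-t : ℂ) (by simpa using (abs_lt.2 ht).le)).norm
    simp only [Complex.norm_exp] at this
    simpa [ProbabilityTheory.integrableExpSet] using this
  have hint0 : (0:ℝ) ∈ interior (ProbabilityTheory.integrableExpSet id ρ) :=
    interior_mono hsub (by rw [interior_Ioo]; constructor <;> linarith)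
  have hFe : ∀ z : ℂ, ∫ y, Complex.exp (-z * (y : ℂ)) ∂ρ = ProbabilityTheory.complexMGF id ρ (-z) := by
    intro z; rfl
  -- real side
  have hmgf : ∀ᶠ t in nhdsWithin (0:ℝ) {0}ᶜ, 0 < slope (ProbabilityTheory.mgf id ρ) 0 t := by
    have h1 := ProbabilityTheory.hasDerivAt_mgf hint0
    rw [hasDerivAt_iff_tendsto_slope] at h1
    exact h1.eventually (lt_mem_nhds (by simpa using hdrift))
  rw [eventually_nhdsWithin_iff, Metric.eventually_nhds_iff] at hmgf
  obtain ⟨δ, hδ, hmgf⟩ := hmgf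
  -- near zero
  have hnear : ∀ᶠ z in nhdsWithin (0:ℂ) {0}ᶜ, ProbabilityTheory.complexMGF id ρ z ≠ 1 := by
    have h1 := ProbabilityTheory.hasDerivAt_complexMGF (X := id) (μ := ρ) (z := 0) (by simpa using hint0)
    refine h1.eventually_ne ?_
    have : ∫ y : ℝ, (y : ℂ) ∂ρ = ((∫ y, y ∂ρ : ℝ) : ℂ) := integral_ofReal
    simp [this, hdrift.ne']
  rw [eventually_nhdsWithin_iff, Metric.eventually_nhds_iff] at hnear
  obtain ⟨r, hr, hnear⟩ := hnear
  -- compact part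
  set B' := max B 1 with hB'
  have hcpt : IsCompact {b : ℝ | r / 2 ≤ |b| ∧ |b| ≤ B'} := by
    refine (isCompact_Icc (a := -B') (b := B')).of_isClosed_subset ?_ ?_
    · exact (isClosed_le continuous_const continuous_abs).inter
        (isClosed_le continuous_abs continuous_const)
    · intro b hb; exact abs_le.1 hb.2
  have hcont : Continuous (fun b : ℝ => ‖1 - ∫ y, Complex.exp (-(Complex.I * b) * (y : ℂ)) ∂ρ‖) := by
    refine (continuous_const.sub ?_).norm
    refine continuous_of_dominated (bound := fun _ => 1) (fun b => by fun_prop) (fun b =>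
      Filter.Eventually.of_forall fun y => ?_) (integrable_const _)
      (Filter.Eventually.of_forall fun y => by fun_prop)
    rw [Complex.norm_exp]; simp
  obtain ⟨m, hm, hmle⟩ := hcpt.exists_forall_le' hcont.continuousOn (a := 0) (by
    intro b hb
    refine haxis b ?_
    rintro rfl
    have := hb.1
    simp at this; linarith)
  set M := 2 / η * ∫ y, Real.exp (η * |y|) ∂ρ with hM
  have hMpos : 0 < M := by
    have : 1 ≤ ∫ y, Real.exp (η * |y|) ∂ρ := by
      have h := integral_mono (μ := ρ) (integrable_const (1:ℝ)) hmom
        (fun y => Real.one_le_exp (by positivity))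
      simpa using h
    positivity
  refine ⟨min (η / 2) δ, by positivity, min (r / 2) (min (c / (2 * M)) (m / (2 * M))),
    by positivity, ?_⟩
  set C := min (r / 2) (min (c / (2 * M)) (m / (2 * M))) with hC
  have hCpos : 0 < C := by positivity
  have hC1 : C ≤ r / 2 := min_le_left _ _
  have hC2 : C * M ≤ c / 2 := by
    have : C ≤ c / (2 * M) := (min_le_right _ _).trans (min_le_left _ _)
    calc C * M ≤ c / (2 * M) * M := by gcongr
      _ = c / 2 := by field_simp
  have hC3 : C * M ≤ m / 2 := by
    have : C ≤ m / (2 * M) := (min_le_right _ _).trans (min_le_right _ _)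
    calc C * M ≤ m / (2 * M) * M := by gcongr
      _ = m / 2 := by field_simp
  intro z hz hzC h1
  have hz1 : |z.re| ≤ η / 2 := (hz.trans_le (min_le_left _ _)).le
  have hz2 : |z.re| < δ := hz.trans_le (min_le_right _ _)
  rcases lt_or_ge 0 z.re with hpos | hneg
  · exfalso
    have h2 := hmgf (y := -z.re) (by simpa using hz2) (by simpa using hpos.ne')
    rw [slope_def_field, ProbabilityTheory.mgf_zero] at h2
    have h3 : 1 ≤ ProbabilityTheory.mgf id ρ (-z.re) := by
      have := ProbabilityTheory.norm_complexMGF_le_mgf (X := id) (μ := ρ) (z := -z)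
      rw [← hFe, h1] at this
      simpa using this
    have h4 : (ProbabilityTheory.mgf id ρ (-z.re) - 1) / (-z.re - 0) ≤ 0 :=
      div_nonpos_of_nonneg_of_nonpos (by linarith) (by linarith)
    linarith
  have hbl : 0 ≤ |z.im| ^ l := by positivity
  have hab : |z.re| ≤ C / (1 + |z.im| ^ l) := by
    rw [abs_of_nonpos hneg]; rw [neg_div] at hzC; linarith
  have hab' : |z.re| ≤ C := hab.trans (div_le_self hCpos.le (by linarith))
  have hlip := aux_lip ρ η hη hmom z hz1
  rw [h1, ← hM] at hlip
  rcases lt_or_ge |z.im| (r / 2) with hs | hs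
  · by_contra hz0
    refine hnear (y := -z) ?_ (by simpa using hz0) (by rw [← hFe, h1])
    have := Complex.norm_le_abs_re_add_abs_im z
    simp only [dist_zero_right, norm_neg]
    linarith
  exfalso
  rcases le_total |z.im| B' with hb | hb
  · have := hmle z.im ⟨hs, hb⟩
    have : |z.re| * M ≤ C * M := by gcongr
    linarith
  · have h2 := hB z.im ((le_max_left _ _).trans hb)
    have h3 : |z.im| ^ l * (|z.re| * M) ≤ C * M := by
      rw [le_div_iff₀ (by linarith)] at hab
      have : |z.im| ^ l * |z.re| ≤ C := by nlinarith [abs_nonneg z.re]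
      rw [← mul_assoc]; gcongr
    have h4 := mul_le_mul_of_nonneg_left hlip hbl
    linarith
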